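/- Let r, p_x, p_y, p_z : ℝ → ℝ be real-analytic on a neighborhood of 0, with r(0) = r₀ > 0, r'(0) = 0, (p_x(0), p_y(0), p_z(0)) = (0,0,0) and (p_x'(0), p_y'(0), p_z'(0)) ≠ (0,0,0). Then for every p ∈ ℝ³ with |p| = r₀ and p · (p_x'(0), p_y'(0), p_z'(0)) = 0, there exist ε > 0 and a real-analytic path δ : (−ε, ε) → ℝ³ such that δ(0) = p and for all t ∈ (−ε, ε): |δ(t)|² = r₀² and |δ(t) − (p_x(t), p_y(t), p_z(t))|² = r(t)². (That is, δ(t) lies in the intersection of the fixed sphere of radius r₀ about the origin with the moving sphere of radius r(t) about (p_x(t), p_y(t), p_z(t)).) -/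

import Mathlib

theorem AnalyticAt.exists_eq_mul {f : ℝ → ℝ} (hf : AnalyticAt ℝ f 0) (h0 : f 0 = 0) :
    ∃ q : ℝ → ℝ, AnalyticAt ℝ q 0 ∧ q 0 = deriv f 0 ∧ ∀ t, f t = t * q t := by
  obtain ⟨s, hs⟩ := hf
  refine ⟨dslope f 0, ⟨_, hs.has_fpower_series_dslope_fslope⟩, dslope_same f 0, fun t => ?_⟩
  have h := sub_smul_dslope f 0 t
  simp only [sub_zero, h0, smul_eq_mul] at h
  exact h.symm

theorem AnalyticAt.real_sqrt {f : ℝ → ℝ} {x : ℝ} (hf : AnalyticAt ℝ f x) (h : f x ≠ 0) :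
    AnalyticAt ℝ (fun t => √(f t)) x :=
  AnalyticAt.comp (g := Real.sqrt) (Real.contDiffAt_sqrt h).analyticAt hf

/-- Analytic intersection of a fixed sphere with an analytically moving sphere that
degenerates to the fixed one at `t = 0`: through each point `p` of the fixed sphere
perpendicular to the initial velocity of the moving center there is an analytic path
staying in the intersection. -/
theorem sphere_intersection_analytic_path (r px py pz : ℝ → ℝ) (r₀ : ℝ)
    (hana : ∃ ε₀ > (0 : ℝ), ∀ t ∈ Set.Ioo (-ε₀) ε₀,
      AnalyticAt ℝ r t ∧ AnalyticAt ℝ px t ∧ AnalyticAt ℝ py t ∧ AnalyticAt ℝ pz t)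
    (hr0 : r 0 = r₀) (hr0pos : r₀ > 0) (hr' : deriv r 0 = 0)
    (hp0 : px 0 = 0 ∧ py 0 = 0 ∧ pz 0 = 0)
    (hp' : ¬ (deriv px 0 = 0 ∧ deriv py 0 = 0 ∧ deriv pz 0 = 0)) :
    ∀ p : Fin 3 → ℝ, p 0 ^ 2 + p 1 ^ 2 + p 2 ^ 2 = r₀ ^ 2 →
      p 0 * deriv px 0 + p 1 * deriv py 0 + p 2 * deriv pz 0 = 0 →
      ∃ ε > (0 : ℝ), ∃ δ : ℝ → (Fin 3 → ℝ),
        δ 0 = p ∧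
        ∀ t ∈ Set.Ioo (-ε) ε, AnalyticAt ℝ δ t ∧
          (δ t 0) ^ 2 + (δ t 1) ^ 2 + (δ t 2) ^ 2 = r₀ ^ 2 ∧
          (δ t 0 - px t) ^ 2 + (δ t 1 - py t) ^ 2 + (δ t 2 - pz t) ^ 2 = r t ^ 2 := by
  intro p hp hpv
  obtain ⟨ε₀, hε₀, hana⟩ := hana
  obtain ⟨hr, hx, hy, hz⟩ := hana 0 ⟨by linarith, hε₀⟩
  obtain ⟨hx0, hy0, hz0⟩ := hp0
  obtain ⟨a, ha, ha0, hat⟩ := hx.exists_eq_mul hx0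
  obtain ⟨b, hb, hb0, hbt⟩ := hy.exists_eq_mul hy0
  obtain ⟨c, hc, hc0, hct⟩ := hz.exists_eq_mul hz0
  obtain ⟨ρ, hρ, hρ0, hρt⟩ :=
    (show AnalyticAt ℝ (fun t => r t - r₀) 0 by fun_prop).exists_eq_mul (by simp [hr0])
  rw [deriv_sub_const, hr'] at hρ0
  rw [← ha0, ← hb0, ← hc0] at hp' hpv
  obtain ⟨g, hg_def⟩ : ∃ g : ℝ → ℝ, g = fun t =>
      (-(ρ t * (r t + r₀)) + t * (a t ^ 2 + b t ^ 2 + c t ^ 2)) / 2 := ⟨_, rfl⟩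
  have hg : AnalyticAt ℝ g 0 := by rw [hg_def]; fun_prop
  have hg0 : g 0 = 0 := by simp [hg_def, hρ0]
  -- the path has to satisfy `δ ⬝ (a, b, c) = g`
  obtain ⟨N, hN_def⟩ : ∃ N : ℝ → ℝ, N = fun t => a t ^ 2 + b t ^ 2 + c t ^ 2 := ⟨_, rfl⟩
  have hN : AnalyticAt ℝ N 0 := by rw [hN_def]; fun_prop
  have hN0 : N 0 ≠ 0 := by
    intro h
    simp only [hN_def] at h
    refine hp' ⟨?_, ?_, ?_⟩ <;> nlinarith [sq_nonneg (a 0), sq_nonneg (b 0), sq_nonneg (c 0)]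
  obtain ⟨k, hk_def⟩ : ∃ k : ℝ → ℝ, k = fun t => (p 0 * a t + p 1 * b t + p 2 * c t) / N t :=
    ⟨_, rfl⟩
  have hk : AnalyticAt ℝ k 0 := by
    rw [hk_def]
    exact AnalyticAt.div (by fun_prop) hN hN0
  have hk0 : k 0 = 0 := by simp [hk_def, hpv]
  -- `W` is the squared norm of the component of `p` orthogonal to `(a, b, c)`
  obtain ⟨W, hW_def⟩ : ∃ W : ℝ → ℝ, W = fun t =>
      (p 0 - k t * a t) ^ 2 + (p 1 - k t * b t) ^ 2 + (p 2 - k t * c t) ^ 2 := ⟨_, rfl⟩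
  have hW : AnalyticAt ℝ W 0 := by rw [hW_def]; fun_prop
  have hW0 : W 0 = r₀ ^ 2 := by simp [hW_def, hk0, hp]
  have hW0' : W 0 ≠ 0 := by rw [hW0]; positivity
  obtain ⟨m, hm_def⟩ : ∃ m : ℝ → ℝ, m = fun t => g t / N t := ⟨_, rfl⟩
  have hm : AnalyticAt ℝ m 0 := by rw [hm_def]; exact hg.div hN hN0
  have hm0 : m 0 = 0 := by simp [hm_def, hg0]
  obtain ⟨q, hq_def⟩ : ∃ q : ℝ → ℝ, q = fun t => (r₀ ^ 2 - m t ^ 2 * N t) / W t := ⟨_, rfl⟩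
  have hq : AnalyticAt ℝ q 0 := by
    rw [hq_def]
    exact AnalyticAt.div (by fun_prop) hW hW0'
  have hq0 : q 0 = 1 := by
    rw [hW0] at hW0'
    simp [hq_def, hm0, hW0, hW0']
  have hS : AnalyticAt ℝ (fun t => √(q t)) 0 := hq.real_sqrt (by simp [hq0])
  have hδ : AnalyticAt ℝ (fun t => ![m t * a t + √(q t) * (p 0 - k t * a t),
      m t * b t + √(q t) * (p 1 - k t * b t),
      m t * c t + √(q t) * (p 2 - k t * c t)]) 0 := by
    rw [analyticAt_pi_iff]
    intro i
    fin_cases i <;> simp <;> fun_prop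
  have hev := hδ.eventually_analyticAt.and <|
    (hN.continuousAt.eventually_ne hN0).and <| (hW.continuousAt.eventually_ne hW0').and <|
    hq.continuousAt.eventually (lt_mem_nhds (show 0 < q 0 by simp [hq0]))
  obtain ⟨ε, hε, hball⟩ := Metric.eventually_nhds_iff_ball.1 hev
  refine ⟨ε, hε, fun t => ![m t * a t + √(q t) * (p 0 - k t * a t),
      m t * b t + √(q t) * (p 1 - k t * b t),
      m t * c t + √(q t) * (p 2 - k t * c t)], ?_, fun t ht => ?_⟩
  · ext i
    fin_cases i <;> simp [hm0, hk0, hq0]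
  · obtain ⟨h1, hNt, hWt, hqt⟩ := hball t (by rwa [Real.ball_eq_Ioo, zero_sub, zero_add])
    have hs : √(q t) ^ 2 * W t = r₀ ^ 2 - m t ^ 2 * N t := by
      rw [Real.sq_sqrt hqt.le, hq_def]
      exact div_mul_cancel₀ _ hWt
    have hmt : m t * N t = g t := by rw [hm_def]; exact div_mul_cancel₀ _ hNt
    have hkt : k t * N t = p 0 * a t + p 1 * b t + p 2 * c t := by
      rw [hk_def]; exact div_mul_cancel₀ _ hNt
    have hrt := hρt t
    simp only [hN_def, hW_def, hg_def] at hs hmt hkt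
    have hsq : (m t * a t + √(q t) * (p 0 - k t * a t)) ^ 2 +
        (m t * b t + √(q t) * (p 1 - k t * b t)) ^ 2 +
        (m t * c t + √(q t) * (p 2 - k t * c t)) ^ 2 = r₀ ^ 2 := by
      linear_combination hs - 2 * m t * √(q t) * hkt
    refine ⟨h1, ?_, ?_⟩
    · simpa using hsq
    · simp only [Matrix.cons_val_zero, Matrix.cons_val_one, Matrix.cons_val]
      rw [hat, hbt, hct]
      linear_combination hsq - 2 * t * hmt + 2 * t * √(q t) * hkt - (r t + r₀) * hrt
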